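/- There is a constant δ > 0 (one may take δ = 1/6140) such that for every finite simple graph G of order n with maximum degree at most 3, every eigenvalue λ_i(G) with index i satisfying (1/2 − δ)n ≤ i ≤ (1/2 + δ)n lies in the interval [−√2, √2]. -/

import Mathlib

open Polynomial in
/-- `μ` is the sequence of adjacency eigenvalues of `G`, listed with multiplicity
in decreasing order (so `μ ⟨i-1,_⟩` is the `i`-th largest eigenvalue `λ_i`). -/
def SimpleGraph.IsEigenvalueSeq {V : Type*} [Fintype V] [DecidableEq V]
    (G : SimpleGraph V) (μ : Fin (Fintype.card V) → ℝ) : Prop :=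
  Antitone μ ∧
    (letI : DecidableRel G.Adj := Classical.decRel _
     (SimpleGraph.adjMatrix ℝ G).charpoly) =
      ∏ i : Fin (Fintype.card V), (X - C (μ i))

/-- Spectral data of a real symmetric matrix. -/
structure IsSpec {V : Type*} [Fintype V] [DecidableEq V] (A : Matrix V V ℝ)
    (lam : V → ℝ) (b : V → V → ℝ) : Prop where
  row : ∀ i, ∑ v, b i v * b i v = 1
  col : ∀ u v, ∑ i, b i u * b i v = if u = v then 1 else 0
  eig : ∀ i v, ∑ u, A v u * b i u = lam i * b i v

theorem exists_isSpec {V : Type*} [Fintype V] [DecidableEq V] (A : Matrix V V ℝ)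
    (hA : A.IsHermitian) : ∃ lam b, IsSpec A lam b ∧
      A.charpoly = ∏ i, (Polynomial.X - Polynomial.C (lam i)) := by
  refine ⟨hA.eigenvalues, fun i v => hA.eigenvectorBasis i v, ⟨?_, ?_, ?_⟩, ?_⟩
  · intro i
    have h := hA.eigenvectorBasis.orthonormal.1 i
    have h2 : inner ℝ (hA.eigenvectorBasis i) (hA.eigenvectorBasis i) = (1 : ℝ) := by
      rw [real_inner_self_eq_norm_sq, h]; norm_num
    rw [PiLp.inner_apply] at h2
    simpa [sq] using h2
  · intro u v
    have h := hA.eigenvectorBasis.sum_inner_mul_inner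
      (EuclideanSpace.single u (1:ℝ)) (EuclideanSpace.single v (1:ℝ))
    simp [EuclideanSpace.inner_single_left, EuclideanSpace.inner_single_right] at h
    rw [h]
    simp [eq_comm]
  · intro i v
    have h := congrFun (hA.mulVec_eigenvectorBasis i) v
    simpa [Matrix.mulVec, dotProduct] using h
  · simpa using hA.charpoly_eq

namespace IsSpec
variable {V : Type*} [Fintype V] [DecidableEq V] {A : Matrix V V ℝ}
    {lam : V → ℝ} {b : V → V → ℝ}

theorem pow (h : IsSpec A lam b) (m : ℕ) (u v : V) :
    ∑ i, lam i ^ m * (b i u * b i v) = (A ^ m) u v := by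
  induction m generalizing u v with
  | zero => simp [h.col, Matrix.one_apply]
  | succ m ih =>
    rw [pow_succ', Matrix.mul_apply]
    simp_rw [← ih, Finset.mul_sum]
    rw [Finset.sum_comm]
    refine Finset.sum_congr rfl fun i _ => ?_
    have := h.eig i u
    calc lam i ^ (m+1) * (b i u * b i v) = (lam i * b i u) * (lam i ^ m * b i v) := by ring
      _ = _ := by rw [← this, Finset.sum_mul]; exact Finset.sum_congr rfl fun w _ => by ring

theorem form (h : IsSpec A lam b) (m : ℕ) (x : V → ℝ) :
    ∑ i, lam i ^ m * (∑ v, b i v * x v) ^ 2 = ∑ u, ∑ v, (A ^ m) u v * (x u * x v) := by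
  simp_rw [← h.pow, Finset.sum_mul]
  have : ∀ i, lam i ^ m * (∑ v, b i v * x v) ^ 2
      = ∑ u, ∑ v, lam i ^ m * (b i u * b i v) * (x u * x v) := by
    intro i
    rw [sq, Finset.sum_mul_sum, Finset.mul_sum]
    refine Finset.sum_congr rfl fun u _ => ?_
    rw [Finset.mul_sum]
    exact Finset.sum_congr rfl fun v _ => by ring
  simp_rw [this]
  rw [Finset.sum_comm]
  refine Finset.sum_congr rfl fun u _ => ?_
  rw [Finset.sum_comm]

theorem form_one (h : IsSpec A lam b) (x : V → ℝ) :
    ∑ i, lam i * (∑ v, b i v * x v) ^ 2 = ∑ u, ∑ v, A u v * (x u * x v) := by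
  simpa using h.form 1 x

theorem form_zero (h : IsSpec A lam b) (x : V → ℝ) :
    ∑ i, (∑ v, b i v * x v) ^ 2 = ∑ u, x u ^ 2 := by
  have := h.form 0 x
  simpa [Matrix.one_apply, sq] using this

/-- negative space meets nonnegative space trivially -/
theorem zero_of (h : IsSpec A lam b) (x : V → ℝ) (c : ℝ)
    (h0 : ∀ i, ¬ lam i < c → ∑ v, b i v * x v = 0)
    (h1 : c * ∑ u, x u ^ 2 ≤ ∑ u, ∑ v, A u v * (x u * x v)) : x = 0 := by
  rw [← h.form_zero, ← h.form_one, Finset.mul_sum, ← sub_nonneg, ← Finset.sum_sub_distrib] at h1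
  have h2 : ∀ i ∈ Finset.univ, lam i * (∑ v, b i v * x v) ^ 2 - c * (∑ v, b i v * x v) ^ 2 ≤ 0 := by
    intro i _
    by_cases hi : lam i < c
    · nlinarith [sq_nonneg (∑ v, b i v * x v)]
    · simp [h0 i hi]
  have h3 := (Finset.sum_eq_zero_iff_of_nonpos h2).1 (le_antisymm (Finset.sum_nonpos h2) h1)
  have h4 : ∀ i, (∑ v, b i v * x v) ^ 2 = 0 := by
    intro i
    by_cases hi : lam i < c
    · have := h3 i (Finset.mem_univ i)
      have h5 : (lam i - c) * (∑ v, b i v * x v) ^ 2 = 0 := by linarith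
      rcases mul_eq_zero.1 h5 with h6 | h6
      · linarith
      · exact h6
    · simp [h0 i hi]
  have h5 := h.form_zero x
  simp_rw [h4] at h5
  simp only [Finset.sum_const_zero] at h5
  funext v
  have := (Finset.sum_eq_zero_iff_of_nonneg (fun u _ => sq_nonneg (x u))).1 h5.symm v
    (Finset.mem_univ v)
  simpa using this

/-- Subspace bound. -/
theorem card_le_of_form (h : IsSpec A lam b) (c : ℝ) {ι : Type*} [Fintype ι] (φ : ι → V → ℝ)
    (hinj : ∀ z : ι → ℝ, (∀ v, ∑ i, z i * φ i v = 0) → z = 0)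
    (hform : ∀ (z : ι → ℝ) (x : V → ℝ), (∀ v, x v = ∑ i, z i * φ i v) →
      c * ∑ u, x u ^ 2 ≤ ∑ u, ∑ v, A u v * (x u * x v)) :
    (Finset.univ.filter fun i => lam i < c).card + Fintype.card ι ≤ Fintype.card V := by
  classical
  let L : (ι → ℝ) →ₗ[ℝ] ({i : V // ¬ lam i < c} → ℝ) :=
    { toFun := fun z i => ∑ v, b i v * ∑ j, z j * φ j v
      map_add' := by
        intro z z'; funext i
        simp [add_mul, Finset.sum_add_distrib, mul_add]
      map_smul' := by
        intro r z; funext i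
        simp only [Pi.smul_apply, smul_eq_mul, RingHom.id_apply, Finset.mul_sum]
        exact Finset.sum_congr rfl fun v _ => Finset.sum_congr rfl fun j _ => by ring }
  have hL : Function.Injective L := by
    rw [← LinearMap.ker_eq_bot, LinearMap.ker_eq_bot']
    intro z hz
    apply hinj
    have := h.zero_of (fun v => ∑ i, z i * φ i v) c
      (fun i hi => congrFun hz ⟨i, hi⟩) (hform z _ fun _ => rfl)
    exact fun v => congrFun this v
  have h1 := LinearMap.finrank_le_finrank_of_injective hL
  simp only [Module.finrank_fintype_fun_eq_card] at h1
  have h2 := Fintype.card_subtype_compl (fun i : V => lam i < c)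
  rw [h2, Fintype.card_subtype] at h1
  have h3 : (Finset.univ.filter fun i => lam i < c).card ≤ Fintype.card V := Finset.card_le_univ _
  omega

/-- Deleting the vertices of `N`. -/
theorem card_le_of_delete {B : Matrix V V ℝ} {lam' : V → ℝ} {b' : V → V → ℝ}
    (h : IsSpec A lam b) (h' : IsSpec B lam' b') (c : ℝ) (N : Finset V)
    (hAB : ∀ u v, u ∉ N → v ∉ N → A u v = B u v) :
    (Finset.univ.filter fun i => lam i < c).card ≤
      N.card + (Finset.univ.filter fun i => lam' i < c).card := by
  classical
  let L : (V → ℝ) →ₗ[ℝ] (({i : V // ¬ lam i < c} ⊕ ({i : V // lam' i < c} ⊕ N)) → ℝ) :=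
    { toFun := fun x i => Sum.elim (fun i : {i : V // ¬ lam i < c} => ∑ v, b i v * x v)
        (Sum.elim (fun i : {i : V // lam' i < c} => ∑ v, b' i v * x v) (fun v : N => x v)) i
      map_add' := by
        intro z z'; funext i
        rcases i with i | i | i <;> simp [Finset.sum_add_distrib, mul_add]
      map_smul' := by
        intro r z; funext i
        rcases i with i | i | i
        · simp only [Pi.smul_apply, smul_eq_mul, RingHom.id_apply, Finset.mul_sum, Sum.elim_inl]
          exact Finset.sum_congr rfl fun v _ => by ring
        · simp only [Pi.smul_apply, smul_eq_mul, RingHom.id_apply, Finset.mul_sum, Sum.elim_inl,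
            Sum.elim_inr]
          exact Finset.sum_congr rfl fun v _ => by ring
        · simp }
  have hL : Function.Injective L := by
    rw [← LinearMap.ker_eq_bot, LinearMap.ker_eq_bot']
    intro x hx
    have e1 : ∀ i, ¬ lam i < c → ∑ v, b i v * x v = 0 := fun i hi => congrFun hx (Sum.inl ⟨i, hi⟩)
    have e2 : ∀ i, lam' i < c → ∑ v, b' i v * x v = 0 :=
      fun i hi => congrFun hx (Sum.inr (Sum.inl ⟨i, hi⟩))
    have e3 : ∀ v, v ∈ N → x v = 0 := fun v hv => congrFun hx (Sum.inr (Sum.inr ⟨v, hv⟩))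
    apply h.zero_of x c e1
    have e4 : ∑ u, ∑ v, A u v * (x u * x v) = ∑ u, ∑ v, B u v * (x u * x v) := by
      refine Finset.sum_congr rfl fun u _ => Finset.sum_congr rfl fun v _ => ?_
      by_cases hu : u ∈ N
      · simp [e3 u hu]
      by_cases hv : v ∈ N
      · simp [e3 v hv]
      rw [hAB u v hu hv]
    rw [e4, ← h'.form_zero, ← h'.form_one, Finset.mul_sum]
    refine Finset.sum_le_sum fun i _ => ?_
    by_cases hi : lam' i < c
    · simp [e2 i hi]
    · nlinarith [sq_nonneg (∑ v, b' i v * x v)]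
  have h1 := LinearMap.finrank_le_finrank_of_injective hL
  simp only [Module.finrank_fintype_fun_eq_card, Fintype.card_sum, Fintype.card_coe] at h1
  have h2 := Fintype.card_subtype_compl (fun i : V => lam i < c)
  rw [h2, Fintype.card_subtype, Fintype.card_subtype] at h1
  have h3 : (Finset.univ.filter fun i => lam i < c).card ≤ Fintype.card V := Finset.card_le_univ _
  omega

end IsSpec

/-- The degree-six majorant of the indicator of `[√2, 3]`. -/
noncomputable def qpoly (x : ℝ) : ℝ :=
  1 / 2 - (9 + 4 * √2) / 1176 * (x ^ 4 - 11 * x ^ 2 + 18)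
    + (9 + 4 * √2) / 1176 * (74 * √2 - 72) * x
    + (9 + 4 * √2) / 1176 * (12 - 10 * √2) * x ^ 3
    - 1 / 10000 * (-x ^ 6 + 13 * x ^ 4 - 40 * x ^ 2 + 36)

theorem sqrt_two_bounds : (1.414 : ℝ) < √2 ∧ √2 < 1.415 ∧ √2 * √2 = 2 := by
  refine ⟨?_, ?_, ?_⟩
  · rw [Real.lt_sqrt (by norm_num)]; norm_num
  · rw [Real.sqrt_lt' (by norm_num)]; norm_num
  · exact Real.mul_self_sqrt (by norm_num)

theorem qpoly_nonneg (x : ℝ) (h1 : -3 ≤ x) (h2 : x ≤ 3) : 0 ≤ qpoly x := by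
  obtain ⟨a1, a2, a3⟩ := sqrt_two_bounds
  have key : qpoly x = (x + √2) ^ 2 * (x + 3) *
      ((9 + 4 * √2) / 1176 * (15 - 8 * √2 - x) - 1 / 10000 * (x - √2) ^ 2 * (3 - x)) := by
    unfold qpoly
    generalize √2 = s at *
    have e : s ^ 2 = 2 := by rw [sq]; exact a3
    have e3 : s ^ 3 = 2 * s := by rw [pow_succ, e]
    have e4 : s ^ 4 = 4 := by rw [show s ^ 4 = (s ^ 2) ^ 2 by ring, e]; norm_num
    ring_nf
    simp only [e, e3, e4]
    ring
  rw [key]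
  generalize √2 = s at *
  have h5 : (x - s) ^ 2 ≤ 20 := by nlinarith
  have h6 : 0 ≤ (9 + 4 * s) / 1176 * (15 - 8 * s - x) - 1 / 10000 * (x - s) ^ 2 * (3 - x) := by
    have : (1/100:ℝ) ≤ (9 + 4 * s) / 1176 := by linarith
    have b1 : 1 / 100 * (3 - x) ≤ (9 + 4 * s) / 1176 * (15 - 8 * s - x) :=
      mul_le_mul this (by linarith) (by linarith) (by linarith)
    have b2 : (x - s) ^ 2 * (3 - x) ≤ 20 * (3 - x) := mul_le_mul_of_nonneg_right h5 (by linarith)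
    nlinarith
  exact mul_nonneg (mul_nonneg (sq_nonneg _) (by linarith)) h6

theorem qpoly_ge_one (x : ℝ) (h1 : √2 ≤ x) (h2 : x ≤ 3) : 1 ≤ qpoly x := by
  obtain ⟨a1, a2, a3⟩ := sqrt_two_bounds
  have key : qpoly x - 1 = (x - √2) * (3 - x) *
      ((9 + 4 * √2) / 1176 * (x ^ 2 + (11 * √2 - 9) * x + (21 * √2 - 16))
        - 1 / 10000 * ((x - √2) * (x + √2) ^ 2 * (3 + x))) := by
    unfold qpoly
    generalize √2 = s at *
    have e : s ^ 2 = 2 := by rw [sq]; exact a3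
    have e3 : s ^ 3 = 2 * s := by rw [pow_succ, e]
    have e4 : s ^ 4 = 4 := by rw [show s ^ 4 = (s ^ 2) ^ 2 by ring, e]; norm_num
    ring_nf
    simp only [e, e3, e4]
    ring
  have : 0 ≤ qpoly x - 1 := by
    rw [key]
    generalize √2 = s at *
    have h6 : 0 ≤ (9 + 4 * s) / 1176 * (x ^ 2 + (11 * s - 9) * x + (21 * s - 16))
        - 1 / 10000 * ((x - s) * (x + s) ^ 2 * (3 + x)) := by
      have c1 : (1/100:ℝ) ≤ (9 + 4 * s) / 1176 := by linarith
      have c2 : (13:ℝ) ≤ x ^ 2 + (11 * s - 9) * x + (21 * s - 16) := by nlinarith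
      have b1 : 1 / 100 * 13 ≤ (9 + 4 * s) / 1176 * (x ^ 2 + (11 * s - 9) * x + (21 * s - 16)) :=
        mul_le_mul c1 c2 (by linarith) (by linarith)
      have b3 : (x + s) ^ 2 ≤ 20 := by nlinarith
      have b4 : (x - s) * (x + s) ^ 2 ≤ 1.6 * 20 :=
        mul_le_mul (by linarith) b3 (by positivity) (by linarith)
      have b5 : (x - s) * (x + s) ^ 2 * (3 + x) ≤ 1.6 * 20 * 6 :=
        mul_le_mul b4 (by linarith) (by linarith) (by norm_num)
      linarith
    exact mul_nonneg (mul_nonneg (by linarith) (by linarith)) h6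
  linarith

section adj
variable {V : Type*} [Fintype V] [DecidableEq V] (G : SimpleGraph V) [DecidableRel G.Adj]

theorem IsSpec.abs_le_three {lam : V → ℝ} {b : V → V → ℝ} (h : IsSpec (G.adjMatrix ℝ) lam b)
    (hdeg : ∀ v, G.degree v ≤ 3) (i : V) : |lam i| ≤ 3 := by
  obtain ⟨u, -, hu⟩ := Finset.exists_max_image Finset.univ (fun v => |b i v|) ⟨i, Finset.mem_univ i⟩
  have hpos : 0 < |b i u| := by
    by_contra hc
    have hz : ∀ v, b i v = 0 := fun v => by
      have := hu v (Finset.mem_univ v)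
      exact abs_nonpos_iff.1 (by linarith)
    have := h.row i
    simp [hz] at this
  have h1 := h.eig i u
  have h2 : |lam i| * |b i u| ≤ 3 * |b i u| := by
    rw [← abs_mul, ← h1]
    simp only [SimpleGraph.adjMatrix_apply, ite_mul, one_mul, zero_mul]
    rw [← Finset.sum_filter]
    calc _ ≤ ∑ v ∈ Finset.univ.filter (fun v => G.Adj u v), |b i v| := Finset.abs_sum_le_sum_abs _ _
      _ ≤ (Finset.univ.filter (fun v => G.Adj u v)).card • |b i u| :=
        Finset.sum_le_card_nsmul _ _ _ fun v hv => hu v (Finset.mem_univ v)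
      _ ≤ 3 * |b i u| := by
        rw [nsmul_eq_mul]
        have : (Finset.univ.filter (fun v => G.Adj u v)).card ≤ 3 := by
          rw [← G.neighborFinset_eq_filter]; exact hdeg u
        gcongr
        exact_mod_cast this
  exact le_of_mul_le_mul_right h2 hpos

theorem adj_pow_int (m : ℕ) (u v : V) : ∃ k : ℕ, ((G.adjMatrix ℝ) ^ m) u v = k := by
  refine ⟨((G.adjMatrix ℕ) ^ m) u v, ?_⟩
  have : (G.adjMatrix ℝ) = (Nat.castRingHom ℝ).mapMatrix (G.adjMatrix ℕ) := by
    ext u v; simp [SimpleGraph.adjMatrix_apply]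
  rw [this, ← map_pow]
  simp

theorem adj_sq_self (v : V) : ((G.adjMatrix ℝ) ^ 2) v v = G.degree v := by
  rw [sq, G.adjMatrix_mul_self_apply_self]

theorem adj_four_ge (v : V) : (G.degree v : ℝ) ^ 2 - G.degree v +
    ∑ u ∈ G.neighborFinset v, (G.degree u : ℝ) ≤ ((G.adjMatrix ℝ) ^ 4) v v := by
  have h1 : ((G.adjMatrix ℝ) ^ 4) v v = ∑ u, (((G.adjMatrix ℝ) ^ 2) v u) ^ 2 := by
    rw [show 4 = 2 + 2 by rfl, pow_add, Matrix.mul_apply]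
    refine Finset.sum_congr rfl fun u _ => ?_
    have : ((G.adjMatrix ℝ) ^ 2).transpose = (G.adjMatrix ℝ) ^ 2 := by
      rw [Matrix.transpose_pow, SimpleGraph.transpose_adjMatrix]
    have h2 : ((G.adjMatrix ℝ) ^ 2) u v = ((G.adjMatrix ℝ) ^ 2) v u := by
      conv_lhs => rw [← this]
      rfl
    rw [h2, sq (((G.adjMatrix ℝ) ^ 2) v u)]
  have h3 : ∑ u ∈ G.neighborFinset v, (G.degree u : ℝ) = ∑ u, ((G.adjMatrix ℝ) ^ 2) v u := by
    simp_rw [sq, SimpleGraph.adjMatrix_mul_apply]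
    rw [Finset.sum_comm]
    refine Finset.sum_congr rfl fun u _ => ?_
    simp [SimpleGraph.adjMatrix_apply, ← SimpleGraph.card_neighborFinset_eq_degree, SimpleGraph.neighborFinset_eq_filter]
  rw [h1, h3, ← adj_sq_self, ← Finset.add_sum_erase _ _ (Finset.mem_univ v),
    ← Finset.add_sum_erase (a := v) (f := fun u => (((G.adjMatrix ℝ) ^ 2) v u) ^ 2) _ (Finset.mem_univ v)]
  have : ∑ u ∈ Finset.univ.erase v, ((G.adjMatrix ℝ) ^ 2) v u ≤
      ∑ u ∈ Finset.univ.erase v, (((G.adjMatrix ℝ) ^ 2) v u) ^ 2 := by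
    refine Finset.sum_le_sum fun u _ => ?_
    obtain ⟨k, hk⟩ := adj_pow_int G 2 v u
    rw [hk]
    exact_mod_cast Nat.le_self_pow (by norm_num) k
  linarith

end adj

section core
variable {V : Type*} [Fintype V] [DecidableEq V] (G : SimpleGraph V) [DecidableRel G.Adj]

theorem core_local {lam : V → ℝ} {b : V → V → ℝ} (h : IsSpec (G.adjMatrix ℝ) lam b)
    (hdeg : ∀ v, G.degree v ≤ 3) (σ : ℝ) (hσ : σ = 1 ∨ σ = -1) (v : V)
    (h3 : 0 ≤ σ * ((G.adjMatrix ℝ) ^ 3) v v) :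
    ∃ r : ℕ, (∑ i ∈ Finset.univ.filter (fun i => √2 < σ * lam i), b i v * b i v ≤
      1 / 2 - (9 + 4 * √2) / 1176 * ((G.degree v : ℝ) ^ 2 - 12 * G.degree v + 18 +
        ∑ u ∈ G.neighborFinset v, (G.degree u : ℝ)) - 1 / 10000 * r) ∧
      (r = 0 → ∑ i ∈ Finset.univ.filter (fun i => √2 < σ * lam i), b i v * b i v ≤ 1 / 7) := by
  obtain ⟨a1, a2, a3⟩ := sqrt_two_bounds
  have hσ2 : σ ^ 2 = 1 := by rcases hσ with rfl | rfl <;> norm_num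
  have hσ3 : σ ^ 3 = σ := by rw [pow_succ, hσ2, one_mul]
  have hσ4 : σ ^ 4 = 1 := by rw [show σ ^ 4 = (σ ^ 2) ^ 2 by ring, hσ2]; norm_num
  have hσ6 : σ ^ 6 = 1 := by rw [show σ ^ 6 = (σ ^ 2) ^ 3 by ring, hσ2]; norm_num
  have habs : ∀ i, -3 ≤ σ * lam i ∧ σ * lam i ≤ 3 := by
    intro i
    have := abs_le.1 (h.abs_le_three G hdeg i)
    rcases hσ with rfl | rfl <;> constructor <;> linarith [this.1, this.2]
  have hw : ∀ i, 0 ≤ b i v * b i v := fun i => mul_self_nonneg _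
  have M0 : ∑ i, b i v * b i v = 1 := by simpa using h.pow 0 v v
  have M1 : ∑ i, lam i * (b i v * b i v) = 0 := by simpa using h.pow 1 v v
  have M2 : ∑ i, lam i ^ 2 * (b i v * b i v) = G.degree v := by rw [h.pow, adj_sq_self]
  have M3 := h.pow 3 v v
  have M4 := h.pow 4 v v
  have M6 := h.pow 6 v v
  have hd4 := adj_four_ge G v
  set A := G.adjMatrix ℝ with hA
  have hr : ∑ i, ((lam i ^ 2 - 2) ^ 2 * (9 - lam i ^ 2)) * (b i v * b i v) =
      -(A ^ 6) v v + 13 * (A ^ 4) v v - 40 * G.degree v + 36 := by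
    rw [← M6, ← M4, ← M2, show (36:ℝ) = 36 * ∑ i, b i v * b i v by rw [M0]; ring]
    simp only [Finset.mul_sum, ← Finset.sum_add_distrib, ← Finset.sum_sub_distrib,
      ← Finset.sum_neg_distrib]
    exact Finset.sum_congr rfl fun i _ => by ring
  have hrt : ∀ i ∈ Finset.univ, 0 ≤ ((lam i ^ 2 - 2) ^ 2 * (9 - lam i ^ 2)) * (b i v * b i v) := by
    intro i _
    have := habs i
    have h9 : lam i ^ 2 ≤ 9 := by
      rw [← one_mul (lam i ^ 2), ← hσ2, ← mul_pow]; nlinarith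
    exact mul_nonneg (mul_nonneg (sq_nonneg _) (by linarith)) (hw i)
  have hr0 := Finset.sum_nonneg hrt
  obtain ⟨k6, hk6⟩ := adj_pow_int G 6 v v
  obtain ⟨k4, hk4⟩ := adj_pow_int G 4 v v
  obtain ⟨r, hrr⟩ : ∃ r : ℕ, ∑ i, ((lam i ^ 2 - 2) ^ 2 * (9 - lam i ^ 2)) * (b i v * b i v) = (r : ℝ) := by
    have e : ∑ i, ((lam i ^ 2 - 2) ^ 2 * (9 - lam i ^ 2)) * (b i v * b i v) =
      ((-(k6:ℤ) + 13 * k4 - 40 * G.degree v + 36 : ℤ) : ℝ) := by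
      rw [hr, hA, hk6, hk4]; push_cast; ring
    rw [e] at hr0 ⊢
    have : (0:ℤ) ≤ -(k6:ℤ) + 13 * k4 - 40 * G.degree v + 36 := by exact_mod_cast hr0
    obtain ⟨r, hr⟩ := Int.eq_ofNat_of_zero_le this
    exact ⟨r, by rw [hr]; simp⟩
  refine ⟨r, ?_, ?_⟩
  · have h5 : ∑ i ∈ Finset.univ.filter (fun i => √2 < σ * lam i), b i v * b i v ≤
        ∑ i, qpoly (σ * lam i) * (b i v * b i v) := by
      rw [Finset.sum_filter]
      refine Finset.sum_le_sum fun i _ => ?_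
      split_ifs with hi
      · have := qpoly_ge_one _ hi.le (habs i).2
        nlinarith [hw i]
      · exact mul_nonneg (qpoly_nonneg _ (habs i).1 (habs i).2) (hw i)
    have h6 : ∑ i, qpoly (σ * lam i) * (b i v * b i v) =
        1 / 2 - (9 + 4 * √2) / 1176 * ((A ^ 4) v v - 11 * G.degree v + 18)
        + (9 + 4 * √2) / 1176 * (12 - 10 * √2) * (σ * (A ^ 3) v v) - 1 / 10000 * r := by
      have e : ∀ i, qpoly (σ * lam i) * (b i v * b i v) =
          1 / 2 * (b i v * b i v) - (9 + 4 * √2) / 1176 * (lam i ^ 4 * (b i v * b i v)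
          - 11 * (lam i ^ 2 * (b i v * b i v)) + 18 * (b i v * b i v))
          + (9 + 4 * √2) / 1176 * (74 * √2 - 72) * σ * (lam i * (b i v * b i v))
          + (9 + 4 * √2) / 1176 * (12 - 10 * √2) * (σ * (lam i ^ 3 * (b i v * b i v)))
          - 1 / 10000 * (((lam i ^ 2 - 2) ^ 2 * (9 - lam i ^ 2)) * (b i v * b i v)) := by
        intro i
        unfold qpoly
        simp only [mul_pow, hσ2, hσ3, hσ4, hσ6]
        ring
      simp only [e, Finset.sum_add_distrib, Finset.sum_sub_distrib, ← Finset.mul_sum]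
      rw [M0, M1, M2, M3, M4, hrr]
      ring
    rw [h6] at h5
    have h7 : (9 + 4 * √2) / 1176 * (12 - 10 * √2) * (σ * (A ^ 3) v v) ≤ 0 := by
      apply mul_nonpos_of_nonpos_of_nonneg _ h3
      apply mul_nonpos_of_nonneg_of_nonpos <;> linarith
    have h8 : (9 + 4 * √2) / 1176 * ((G.degree v : ℝ) ^ 2 - 12 * G.degree v + 18 +
        ∑ u ∈ G.neighborFinset v, (G.degree u : ℝ)) ≤
        (9 + 4 * √2) / 1176 * ((A ^ 4) v v - 11 * G.degree v + 18) := by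
      apply mul_le_mul_of_nonneg_left _ (by positivity)
      linarith
    linarith
  · intro hz
    rw [hz, Nat.cast_zero] at hrr
    have h0 := (Finset.sum_eq_zero_iff_of_nonneg hrt).1 hrr
    have h5 : ∑ i ∈ Finset.univ.filter (fun i => √2 < σ * lam i), b i v * b i v ≤
        ∑ i, (1 / 7 * (lam i ^ 2 * (b i v * b i v)) - 2 / 7 * (b i v * b i v)) := by
      rw [Finset.sum_filter]
      refine Finset.sum_le_sum fun i _ => ?_
      have hi0 := h0 i (Finset.mem_univ i)
      have hsq : lam i ^ 2 = (σ * lam i) ^ 2 := by rw [mul_pow, hσ2, one_mul]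
      rcases mul_eq_zero.1 hi0 with hi1 | hi1
      · rcases mul_eq_zero.1 hi1 with hi2 | hi2
        · have hi3 : lam i ^ 2 = 2 := by
            have := pow_eq_zero_iff (two_ne_zero) |>.1 hi2
            linarith
          rw [if_neg]
          · rw [hi3]; linarith
          · intro hlt
            rw [hsq] at hi3
            nlinarith
        · have hi3 : lam i ^ 2 = 9 := by linarith
          rw [hi3]
          split_ifs <;> linarith [hw i]
      · rw [hi1]; simp
    rw [Finset.sum_sub_distrib, ← Finset.mul_sum, ← Finset.mul_sum, M0, M2] at h5
    have : (G.degree v : ℝ) ≤ 3 := by exact_mod_cast hdeg v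
    linarith

theorem core_sum {lam : V → ℝ} {b : V → V → ℝ} (h : IsSpec (G.adjMatrix ℝ) lam b)
    (hdeg : ∀ v, G.degree v ≤ 3) (σ : ℝ) (hσ : σ = 1 ∨ σ = -1) (R : Finset V)
    (hR : ∀ v ∈ R, ∀ u, G.Adj v u → u ∈ R)
    (h3 : ∀ v ∈ R, 0 ≤ σ * ((G.adjMatrix ℝ) ^ 3) v v) :
    ∑ v ∈ R, ∑ i ∈ Finset.univ.filter (fun i => √2 < σ * lam i), b i v * b i v ≤
      (1 / 2 - 1 / 30000) * (R.card : ℝ) := by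
  obtain ⟨a1, a2, a3⟩ := sqrt_two_bounds
  have hloc : ∀ v : V, ∃ r : ℕ, v ∈ R → _ := fun v => by
    by_cases hv : v ∈ R
    · obtain ⟨r, hr⟩ := core_local G h hdeg σ hσ v (h3 v hv)
      exact ⟨r, fun _ => hr⟩
    · exact ⟨0, fun h => absurd h hv⟩
  choose r hr using hloc
  set B : V → ℝ := fun v => ∑ i ∈ Finset.univ.filter (fun i => √2 < σ * lam i), b i v * b i v
  have hB1 : ∀ v, B v ≤ 1 := by
    intro v
    have M0 : ∑ i, b i v * b i v = 1 := by simpa using h.pow 0 v v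
    rw [← M0]
    exact Finset.sum_le_sum_of_subset_of_nonneg (Finset.subset_univ _)
      fun i _ _ => mul_self_nonneg _
  have hdeg2 : ∑ v ∈ R, ∑ u ∈ G.neighborFinset v, (G.degree u : ℝ) =
      ∑ v ∈ R, (G.degree v : ℝ) ^ 2 := by
    have e1 : ∀ v ∈ R, ∑ u ∈ G.neighborFinset v, (G.degree u : ℝ) =
        ∑ u ∈ R, if G.Adj v u then (G.degree u : ℝ) else 0 := by
      intro v hv
      rw [← Finset.sum_filter]
      refine Finset.sum_congr ?_ fun _ _ => rfl
      ext u
      simp only [SimpleGraph.mem_neighborFinset, Finset.mem_filter]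
      exact ⟨fun h => ⟨hR v hv u h, h⟩, fun h => h.2⟩
    rw [Finset.sum_congr rfl e1, Finset.sum_comm]
    refine Finset.sum_congr rfl fun u hu => ?_
    rw [← Finset.sum_filter, Finset.sum_const, nsmul_eq_mul, sq]
    congr 2
    rw [← SimpleGraph.card_neighborFinset_eq_degree]
    congr 1
    ext v
    simp only [SimpleGraph.mem_neighborFinset, Finset.mem_filter]
    exact ⟨fun h => h.2.symm, fun h => ⟨hR u hu v h, h.symm⟩⟩
  have s1 : ∑ v ∈ R, B v ≤ 1 / 2 * (R.card : ℝ) - 1 / 10000 * ∑ v ∈ R, (r v : ℝ) := by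
    have := Finset.sum_le_sum fun v hv => (hr v hv).1
    refine this.trans ?_
    simp only [Finset.sum_sub_distrib, ← Finset.mul_sum, Finset.sum_add_distrib, Finset.sum_const,
      nsmul_eq_mul]
    rw [hdeg2]
    have h9 : 0 ≤ ∑ v ∈ R, 2 * ((G.degree v : ℝ) - 3) ^ 2 :=
      Finset.sum_nonneg fun v _ => by positivity
    have h10 : ∑ v ∈ R, 2 * ((G.degree v : ℝ) - 3) ^ 2 = ∑ v ∈ R, (G.degree v : ℝ) ^ 2
        - 12 * ∑ v ∈ R, (G.degree v : ℝ) + R.card * 18 + ∑ v ∈ R, (G.degree v : ℝ) ^ 2 := by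
      rw [← nsmul_eq_mul, ← Finset.sum_const, Finset.mul_sum]
      simp only [← Finset.sum_add_distrib, ← Finset.sum_sub_distrib]
      exact Finset.sum_congr rfl fun v _ => by ring
    rw [← h10]
    have := mul_nonneg (show 0 ≤ (9 + 4 * √2) / 1176 by positivity) h9
    linarith
  have s2 : ∑ v ∈ R, B v ≤ 1 / 7 * (R.card : ℝ) + 6 / 7 * ∑ v ∈ R, (r v : ℝ) := by
    have : ∀ v ∈ R, B v ≤ 1 / 7 + 6 / 7 * (r v : ℝ) := by
      intro v hv
      rcases Nat.eq_zero_or_pos (r v) with h0 | h0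
      · have := (hr v hv).2 h0
        rw [h0]; simpa using this
      · have h1 : (1:ℝ) ≤ r v := by exact_mod_cast h0
        linarith [hB1 v]
    refine (Finset.sum_le_sum this).trans (le_of_eq ?_)
    rw [Finset.sum_add_distrib, ← Finset.mul_sum, Finset.sum_const, nsmul_eq_mul]; ring
  have hc : (0:ℝ) ≤ R.card := Nat.cast_nonneg _
  linarith

end core

section pos
variable {V : Type*} [Fintype V] [DecidableEq V] (G : SimpleGraph V) [DecidableRel G.Adj]

theorem card_eq_mass {A : Matrix V V ℝ} {lam : V → ℝ} {b : V → V → ℝ} (h : IsSpec A lam b)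
    (S : Finset V) : (S.card : ℝ) = ∑ v, ∑ i ∈ S, b i v * b i v := by
  rw [Finset.sum_comm, Finset.sum_congr rfl fun i _ => h.row i]
  simp

theorem pos_count {lam : V → ℝ} {b : V → V → ℝ} (h : IsSpec (G.adjMatrix ℝ) lam b)
    (hdeg : ∀ v, G.degree v ≤ 3) :
    ((Finset.univ.filter (fun i => √2 < lam i)).card : ℝ) ≤
      (1 / 2 - 1 / 30000) * (Fintype.card V : ℝ) := by
  have := core_sum G h hdeg 1 (Or.inl rfl) Finset.univ (fun _ _ _ _ => Finset.mem_univ _)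
    (fun v _ => by
      obtain ⟨k, hk⟩ := adj_pow_int G 3 v v
      rw [hk]; positivity)
  simp only [one_mul] at this
  rw [card_eq_mass h]
  exact this
end pos

section neg
open Finset
variable {V : Type*} [Fintype V] [DecidableEq V] (G : SimpleGraph V) [DecidableRel G.Adj]

theorem bound_two_form (TT J : Finset (Finset V)) (Nt : Finset V → Finset V)
    (hJ : J ⊆ TT)
    (hcl : ∀ t ∈ TT, ∀ u ∈ t, ∀ v ∈ t, u ≠ v → G.Adj u v)
    (hsep : ∀ t ∈ TT, ∀ t' ∈ TT, t ≠ t' → ∀ v ∈ t, ∀ u ∈ t', v ≠ u ∧ ¬ G.Adj v u)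
    (hout : ∀ t ∈ J, ∀ u ∈ Nt t, u ∉ TT.biUnion id)
    (hne : ∀ t ∈ J, (Nt t).Nonempty)
    (hdisj : ∀ t ∈ J, ∀ t' ∈ J, ∀ u, u ∈ Nt t → u ∈ Nt t' → t = t')
    (hconf : ∀ t ∈ J, ∀ t' ∈ J, ∀ u ∈ Nt t, ∀ u' ∈ Nt t', G.Adj u u' → t = t')
    (hgood : ∀ t ∈ J, ∀ v ∈ t, ∃ u ∈ Nt t, G.Adj v u ∧
      ∀ w, w ∉ TT.biUnion id → G.Adj v w → w = u)
    (huniq : ∀ t ∈ J, ∀ u ∈ Nt t, ∀ v ∈ TT.biUnion id, G.Adj v u → v ∈ t)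
    (x : V → ℝ) (C : Finset V → ℝ)
    (hx1 : ∀ t ∈ J, ∀ u ∈ Nt t, x u = C t)
    (hx0 : ∀ u, u ∉ TT.biUnion id → (∀ t ∈ J, u ∉ Nt t) → x u = 0) :
    0 ≤ ∑ u, ∑ v, G.adjMatrix ℝ u v * (x u * x v) + ∑ u, x u ^ 2 := by
  set T := TT.biUnion id with hT
  set A := G.adjMatrix ℝ with hA
  have hAs : ∀ u v, A u v = A v u := fun u v => by
    simp [hA, SimpleGraph.adjMatrix_apply, SimpleGraph.adj_comm]
  have hpd : (TT : Set (Finset V)).PairwiseDisjoint id := by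
    intro t ht t' ht' hne
    rw [Function.onFun, Finset.disjoint_left]
    intro v hv hv'
    exact (hsep t ht t' ht' hne v hv v hv').1 rfl
  set D : Finset V → ℝ := fun t => if t ∈ J then C t else 0 with hD
  -- part (i)
  have i1 : 0 ≤ ∑ u ∈ Tᶜ, ∑ v ∈ Tᶜ, A u v * (x u * x v) := by
    refine sum_nonneg fun u hu => sum_nonneg fun v hv => ?_
    rw [mem_compl] at hu hv
    rw [hA, SimpleGraph.adjMatrix_apply]
    split_ifs with huv
    · rw [one_mul]
      by_cases h1 : ∀ t ∈ J, u ∉ Nt t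
      · rw [hx0 u hu h1]; simp
      by_cases h2 : ∀ t ∈ J, v ∉ Nt t
      · rw [hx0 v hv h2]; simp
      push Not at h1 h2
      obtain ⟨t, ht, hut⟩ := h1
      obtain ⟨t', ht', hvt⟩ := h2
      have e := hconf t ht t' ht' u hut v hvt huv
      subst e
      rw [hx1 t ht u hut, hx1 t ht v hvt]
      exact mul_self_nonneg _
    · simp
  -- part (ii)
  have i2 : ∑ u ∈ T, ∑ v ∈ T, A u v * (x u * x v) + ∑ u ∈ T, x u ^ 2 =
      ∑ t ∈ TT, (∑ v ∈ t, x v) ^ 2 := by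
    rw [← sum_add_distrib, hT, sum_biUnion hpd]
    refine sum_congr rfl fun t ht => ?_
    rw [sq (∑ v ∈ t, x v), sum_mul]
    refine sum_congr rfl fun u hu => ?_
    have hu : u ∈ t := hu
    have e : ∑ v ∈ TT.biUnion id, A u v * (x u * x v) = ∑ v ∈ t.erase u, x u * x v := by
      symm
      have hsub : t.erase u ⊆ TT.biUnion id := fun v hv =>
        mem_biUnion.2 ⟨t, ht, mem_of_mem_erase hv⟩
      have e3 : ∑ v ∈ t.erase u, x u * x v = ∑ v ∈ t.erase u, A u v * (x u * x v) := by
        refine sum_congr rfl fun v hv => ?_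
        rw [mem_erase] at hv
        simp [hA, SimpleGraph.adjMatrix_apply, hcl t ht u hu v hv.2 hv.1.symm]
      rw [e3]
      apply sum_subset hsub
      intro v hv hvt
      obtain ⟨t', ht', hv'⟩ := mem_biUnion.1 hv
      have : ¬ G.Adj u v := by
        intro hadj
        by_cases htt : t = t'
        · subst htt
          exact hvt (mem_erase.2 ⟨hadj.ne', hv'⟩)
        · exact (hsep t ht t' ht' htt u hu v hv').2 hadj
      simp [hA, SimpleGraph.adjMatrix_apply, this]
    rw [e, ← mul_sum, ← add_sum_erase t x hu]
    ring
  -- part (iii)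
  have i3 : ∑ u ∈ T, ∑ v ∈ Tᶜ, A u v * (x u * x v) = ∑ t ∈ TT, D t * ∑ v ∈ t, x v := by
    have e0 : ∀ t ∈ TT, ∀ u ∈ t, ∑ v ∈ Tᶜ, A u v * (x u * x v) = D t * x u := by
      intro t ht u hu
      by_cases htJ : t ∈ J
      · obtain ⟨w, hw, hadj, hun⟩ := hgood t htJ u hu
        rw [sum_eq_single w]
        · simp [hA, SimpleGraph.adjMatrix_apply, hadj, hD, htJ, hx1 t htJ w hw]; ring
        · intro v hv hvw
          rw [mem_compl] at hv
          have : ¬ G.Adj u v := fun h => hvw (hun v hv h)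
          simp [hA, SimpleGraph.adjMatrix_apply, this]
        · intro h
          exact absurd (mem_compl.2 (hout t htJ w hw)) h
      · simp only [hD, if_neg htJ, zero_mul]
        refine sum_eq_zero fun v hv => ?_
        rw [mem_compl] at hv
        by_cases hadj : G.Adj u v
        · have : x v = 0 := by
            apply hx0 v hv
            intro t' ht' hvt'
            have hut' := huniq t' ht' v hvt' u (mem_biUnion.2 ⟨t, ht, hu⟩) hadj
            by_cases htt : t = t'
            · exact htJ (htt ▸ ht')
            · exact (hsep t ht t' (hJ ht') htt u hu u hut').1 rfl
          rw [this]; simp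
        · simp [hA, SimpleGraph.adjMatrix_apply, hadj]
    rw [hT, sum_biUnion hpd]
    refine sum_congr rfl fun t ht => ?_
    rw [mul_sum]
    exact sum_congr rfl fun u hu => e0 t ht u hu
  -- part (iv)
  have i4 : ∑ t ∈ TT, D t ^ 2 ≤ ∑ u ∈ Tᶜ, x u ^ 2 := by
    have e1 : ∑ t ∈ TT, D t ^ 2 = ∑ t ∈ J, C t ^ 2 := by
      rw [← sum_subset hJ]
      · exact sum_congr rfl fun t ht => by simp [hD, ht]
      · intro t _ ht; simp [hD, ht]
    have e2 : ∑ t ∈ J, C t ^ 2 ≤ ∑ t ∈ J, ∑ u ∈ Nt t, x u ^ 2 := by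
      refine sum_le_sum fun t ht => ?_
      obtain ⟨u, hu⟩ := hne t ht
      rw [← hx1 t ht u hu]
      exact single_le_sum (f := fun u => x u ^ 2) (fun v _ => sq_nonneg (x v)) hu
    have e3 : ∑ t ∈ J, ∑ u ∈ Nt t, x u ^ 2 = ∑ u ∈ J.biUnion Nt, x u ^ 2 := by
      rw [sum_biUnion]
      intro t ht t' ht' hne
      rw [Function.onFun, Finset.disjoint_left]
      intro v hv hv'
      exact hne (hdisj t ht t' ht' v hv hv')
    rw [e1]
    refine e2.trans (e3.le.trans ?_)
    apply sum_le_sum_of_subset_of_nonneg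
    · intro u hu
      obtain ⟨t, ht, hu⟩ := mem_biUnion.1 hu
      exact mem_compl.2 (hout t ht u hu)
    · intro u _ _; positivity
  have i5 : ∑ u ∈ Tᶜ, ∑ v ∈ T, A u v * (x u * x v) = ∑ u ∈ T, ∑ v ∈ Tᶜ, A u v * (x u * x v) := by
    rw [sum_comm]
    exact sum_congr rfl fun u _ => sum_congr rfl fun v _ => by rw [hAs]; ring
  have i6 : ∑ u, ∑ v, A u v * (x u * x v) =
      ∑ u ∈ T, ∑ v ∈ T, A u v * (x u * x v) + ∑ u ∈ T, ∑ v ∈ Tᶜ, A u v * (x u * x v) +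
      (∑ u ∈ Tᶜ, ∑ v ∈ T, A u v * (x u * x v) + ∑ u ∈ Tᶜ, ∑ v ∈ Tᶜ, A u v * (x u * x v)) := by
    rw [← sum_add_distrib, ← sum_add_distrib, ← sum_add_sum_compl T]
    congr 1 <;> exact sum_congr rfl fun u _ => (sum_add_sum_compl T _).symm
  have i7 : 0 ≤ ∑ t ∈ TT, (D t + ∑ v ∈ t, x v) ^ 2 := sum_nonneg fun t _ => sq_nonneg _
  have i8 : ∑ t ∈ TT, (D t + ∑ v ∈ t, x v) ^ 2 = ∑ t ∈ TT, (∑ v ∈ t, x v) ^ 2 +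
      2 * ∑ t ∈ TT, D t * ∑ v ∈ t, x v + ∑ t ∈ TT, D t ^ 2 := by
    rw [mul_sum, ← sum_add_distrib, ← sum_add_distrib]
    exact sum_congr rfl fun t _ => by ring
  rw [i6, ← sum_add_sum_compl T (fun u => x u ^ 2), i5, i3]
  linarith

theorem bound_two {lam : V → ℝ} {b : V → V → ℝ} (h : IsSpec (G.adjMatrix ℝ) lam b)
    (TT J : Finset (Finset V)) (Nt : Finset V → Finset V)
    (hJ : J ⊆ TT)
    (hcl : ∀ t ∈ TT, ∀ u ∈ t, ∀ v ∈ t, u ≠ v → G.Adj u v)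
    (hsep : ∀ t ∈ TT, ∀ t' ∈ TT, t ≠ t' → ∀ v ∈ t, ∀ u ∈ t', v ≠ u ∧ ¬ G.Adj v u)
    (hout : ∀ t ∈ J, ∀ u ∈ Nt t, u ∉ TT.biUnion id)
    (hne : ∀ t ∈ J, (Nt t).Nonempty)
    (hdisj : ∀ t ∈ J, ∀ t' ∈ J, ∀ u, u ∈ Nt t → u ∈ Nt t' → t = t')
    (hconf : ∀ t ∈ J, ∀ t' ∈ J, ∀ u ∈ Nt t, ∀ u' ∈ Nt t', G.Adj u u' → t = t')
    (hgood : ∀ t ∈ J, ∀ v ∈ t, ∃ u ∈ Nt t, G.Adj v u ∧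
      ∀ w, w ∉ TT.biUnion id → G.Adj v w → w = u)
    (huniq : ∀ t ∈ J, ∀ u ∈ Nt t, ∀ v ∈ TT.biUnion id, G.Adj v u → v ∈ t) :
    (univ.filter (fun i => lam i < -√2)).card + ((TT.biUnion id).card + J.card) ≤
      Fintype.card V := by
  have hcard : Fintype.card (↥(TT.biUnion id) ⊕ ↥J) = (TT.biUnion id).card + J.card := by
    rw [Fintype.card_sum, Fintype.card_coe, Fintype.card_coe]
  rw [← hcard]
  let φ : (↥(TT.biUnion id) ⊕ ↥J) → V → ℝ := fun i v => match i with
    | Sum.inl u => if u.1 = v then 1 else 0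
    | Sum.inr t => if v ∈ Nt t.1 then 1 else 0
  have hphi : ∀ (z : (↥(TT.biUnion id) ⊕ ↥J) → ℝ) v, ∑ i, z i * φ i v =
      (∑ u : ↥(TT.biUnion id), if u.1 = v then z (Sum.inl u) else 0) +
      ∑ t : ↥J, if v ∈ Nt t.1 then z (Sum.inr t) else 0 := by
    intro z v
    rw [Fintype.sum_sum_type]
    simp [φ]
  have hT : ∀ (z : (↥(TT.biUnion id) ⊕ ↥J) → ℝ) (u : ↥(TT.biUnion id)),
      ∑ i, z i * φ i u.1 = z (Sum.inl u) := by
    intro z u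
    rw [hphi]
    have e1 : (∑ t : ↥J, if u.1 ∈ Nt t.1 then z (Sum.inr t) else 0) = 0 :=
      sum_eq_zero fun t _ => if_neg fun hu => hout t.1 t.2 u.1 hu u.2
    rw [e1, add_zero, sum_eq_single u]
    · simp
    · intro w _ hw
      exact if_neg fun e => hw (Subtype.ext e)
    · simp
  have hTo : ∀ (z : (↥(TT.biUnion id) ⊕ ↥J) → ℝ) v, v ∉ TT.biUnion id →
      ∑ i, z i * φ i v = ∑ t : ↥J, if v ∈ Nt t.1 then z (Sum.inr t) else 0 := by
    intro z v hv
    rw [hphi]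
    have e1 : (∑ u : ↥(TT.biUnion id), if u.1 = v then z (Sum.inl u) else 0) = 0 :=
      sum_eq_zero fun u _ => if_neg fun (e : u.1 = v) => hv (e ▸ u.2)
    rw [e1, zero_add]
  have hJo : ∀ (z : (↥(TT.biUnion id) ⊕ ↥J) → ℝ) (t : ↥J) v, v ∈ Nt t.1 →
      ∑ i, z i * φ i v = z (Sum.inr t) := by
    intro z t v hv
    rw [hTo z v (hout t.1 t.2 v hv), sum_eq_single t]
    · simp [hv]
    · intro t' _ htt
      exact if_neg fun e => htt (Subtype.ext (hdisj t'.1 t'.2 t.1 t.2 v e hv))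
    · simp
  refine h.card_le_of_form (-√2) φ ?_ ?_
  · intro z hz
    funext i
    rcases i with u | t
    · rw [← hT z u, hz]; rfl
    · obtain ⟨u, hu⟩ := hne t.1 t.2
      rw [← hJo z t u hu, hz]; rfl
  · intro z x hx
    have := bound_two_form G TT J Nt hJ hcl hsep hout hne hdisj hconf hgood huniq x
      (fun t => if ht : t ∈ J then z (Sum.inr ⟨t, ht⟩) else 0) ?_ ?_
    · have h2 : 0 ≤ ∑ u, x u ^ 2 := sum_nonneg fun u _ => sq_nonneg _
      have h3 : (1.414 : ℝ) < √2 := sqrt_two_bounds.1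
      nlinarith
    · intro t ht u hu
      rw [dif_pos ht, hx, hJo z ⟨t, ht⟩ u hu]
    · intro u hu hun
      rw [hx, hTo z u hu]
      exact sum_eq_zero fun t _ => if_neg (hun t.1 t.2)

theorem bound_one {lam : V → ℝ} {b : V → V → ℝ} (h : IsSpec (G.adjMatrix ℝ) lam b)
    (hdeg : ∀ v, G.degree v ≤ 3)
    (TT : Finset (Finset V)) (hc3 : ∀ t ∈ TT, t.card = 3)
    (hcl : ∀ t ∈ TT, ∀ u ∈ t, ∀ v ∈ t, u ≠ v → G.Adj u v)
    (hsep : ∀ t ∈ TT, ∀ t' ∈ TT, t ≠ t' → ∀ v ∈ t, ∀ u ∈ t', v ≠ u ∧ ¬ G.Adj v u)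
    (N : Finset V) (hNT : ∀ u ∈ N, u ∉ TT.biUnion id)
    (hN : ∀ u, u ∉ TT.biUnion id → ∀ v ∈ TT.biUnion id, G.Adj u v → u ∈ N)
    (htri : ∀ u v w, u ∉ TT.biUnion id ∪ N → v ∉ TT.biUnion id ∪ N → w ∉ TT.biUnion id ∪ N →
      G.Adj u v → G.Adj v w → G.Adj w u → False) :
    ((univ.filter (fun i => lam i < -√2)).card : ℝ) ≤
      N.card + (1 / 2 - 1 / 30000) * ((TT.biUnion id ∪ N)ᶜ.card : ℝ) := by
  classical
  obtain ⟨a1, a2, a3⟩ := sqrt_two_bounds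
  let H : SimpleGraph V :=
    { Adj := fun u v => G.Adj u v ∧ u ∉ N ∧ v ∉ N
      symm := ⟨fun u v h => ⟨h.1.symm, h.2.2, h.2.1⟩⟩
      loopless := ⟨fun u h => h.1.ne rfl⟩ }
  have hHA : ∀ u v, H.Adj u v ↔ G.Adj u v ∧ u ∉ N ∧ v ∉ N := fun u v => Iff.rfl
  have hle : H ≤ G := fun u w h => h.1
  have hHdeg : ∀ v, H.degree v ≤ 3 := fun v =>
    (SimpleGraph.degree_le_of_le hle).trans (hdeg v)
  obtain ⟨lam', b', h', -⟩ := exists_isSpec (H.adjMatrix ℝ)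
    (by ext u v; simp [SimpleGraph.adjMatrix_apply, SimpleGraph.adj_comm])
  have hdel := h.card_le_of_delete h' (-√2) N (fun u v hu hv => by
    simp [SimpleGraph.adjMatrix_apply, hHA, hu, hv])
  have hdel' : ((univ.filter (fun i => lam i < -√2)).card : ℝ) ≤
      N.card + ((univ.filter (fun i => lam' i < -√2)).card : ℝ) := by exact_mod_cast hdel
  refine hdel'.trans ?_
  gcongr
  set T := TT.biUnion id with hT
  have hzN : ∀ i, lam' i < -√2 → ∀ v ∈ N, b' i v = 0 := by
    intro i hi v hv
    have := h'.eig i v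
    rw [sum_eq_zero] at this
    · rcases mul_eq_zero.1 this.symm with h0 | h0
      · linarith
      · exact h0
    · intro u _
      simp [SimpleGraph.adjMatrix_apply, hHA, hv]
  have hzT : ∀ i, lam' i < -√2 → ∀ v ∈ T, b' i v = 0 := by
    intro i hi v hv
    obtain ⟨t, ht, hvt⟩ := mem_biUnion.1 hv
    have hvt : v ∈ t := hvt
    have key : ∀ w ∈ t, (lam' i + 1) * b' i w = ∑ u ∈ t, b' i u := by
      intro w hw
      have hwT : w ∈ T := mem_biUnion.2 ⟨t, ht, hw⟩
      have hwN : w ∉ N := fun h => hNT w h hwT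
      have e := h'.eig i w
      have e2 : ∑ u, H.adjMatrix ℝ w u * b' i u = ∑ u ∈ t.erase w, b' i u := by
        symm
        have e3 : ∑ u ∈ t.erase w, b' i u = ∑ u ∈ t.erase w, H.adjMatrix ℝ w u * b' i u := by
          refine sum_congr rfl fun u hu => ?_
          rw [mem_erase] at hu
          have : u ∉ N := fun h => hNT u h (mem_biUnion.2 ⟨t, ht, hu.2⟩)
          simp [SimpleGraph.adjMatrix_apply, hHA, hwN, this, hcl t ht w hw u hu.2 hu.1.symm]
        rw [e3]
        apply sum_subset (subset_univ _)
        intro u _ hu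
        have : ¬ H.Adj w u := by
          rintro ⟨hadj, -, huN⟩
          by_cases huT : u ∈ T
          · obtain ⟨t', ht', hut'⟩ := mem_biUnion.1 huT
            by_cases htt : t = t'
            · subst htt
              exact hu (mem_erase.2 ⟨hadj.ne', hut'⟩)
            · exact (hsep t ht t' ht' htt w hw u hut').2 hadj
          · exact huN (hN u huT w hwT hadj.symm)
        simp [SimpleGraph.adjMatrix_apply, this]
      rw [e2] at e
      rw [← add_sum_erase t _ hw, e]; ring
    have hS : (lam' i + 1) * ∑ u ∈ t, b' i u = 3 * ∑ u ∈ t, b' i u := by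
      rw [mul_sum, sum_congr rfl key, sum_const, hc3 t ht]; simp
    have hS0 : ∑ u ∈ t, b' i u = 0 := by
      have : (lam' i - 2) * ∑ u ∈ t, b' i u = 0 := by linarith
      rcases mul_eq_zero.1 this with h0 | h0
      · linarith
      · exact h0
    have := key v hvt
    rw [hS0] at this
    rcases mul_eq_zero.1 this with h0 | h0
    · linarith
    · exact h0
  have hcore := core_sum H h' hHdeg (-1) (Or.inr rfl) (T ∪ N)ᶜ
    (by
      intro v hv u hvu
      rw [mem_compl, notMem_union] at hv ⊢
      refine ⟨fun huT => ?_, hvu.2.2⟩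
      exact hv.2 (hN v hv.1 u huT hvu.1))
    (by
      intro v hv
      rw [mem_compl] at hv
      have : ((H.adjMatrix ℝ) ^ 3) v v = 0 := by
        rw [show (3:ℕ) = 1 + 1 + 1 from rfl, pow_succ, pow_succ, pow_one]
        rw [Matrix.mul_apply]
        refine sum_eq_zero fun w _ => ?_
        rw [Matrix.mul_apply, sum_mul]
        refine sum_eq_zero fun u _ => ?_
        simp only [SimpleGraph.adjMatrix_apply]
        by_cases h1 : H.Adj v u
        · by_cases h2 : H.Adj u w
          · by_cases h3 : H.Adj w v
            · exfalso
              have hcl' : ∀ a b, a ∉ T ∪ N → H.Adj a b → b ∉ T ∪ N := by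
                intro a b ha hab
                rw [notMem_union] at ha ⊢
                exact ⟨fun hb => ha.2 (hN a ha.1 b hb hab.1), hab.2.2⟩
              have hu := hcl' v u hv h1
              have hw := hcl' u w hu h2
              exact htri v u w hv hu hw h1.1 h2.1 h3.1
            · simp [h3]
          · simp [h2]
        · simp [h1]
      rw [this]; simp)
  have hfil : (univ.filter (fun i => √2 < -1 * lam' i)) = univ.filter (fun i => lam' i < -√2) := by
    ext i
    simp only [mem_filter, mem_univ, true_and]
    constructor <;> intro h <;> linarith
  rw [hfil] at hcore
  rw [card_eq_mass h']
  refine le_trans (le_of_eq ?_) hcore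
  symm
  apply sum_subset (subset_univ _)
  intro v _ hv
  rw [mem_compl, not_not, mem_union] at hv
  refine sum_eq_zero fun i hi => ?_
  rw [mem_filter] at hi
  rcases hv with hv | hv
  · rw [hzT i hi.2 v hv]; simp
  · rw [hzN i hi.2 v hv]; simp

theorem neg_count {lam : V → ℝ} {b : V → V → ℝ} (h : IsSpec (G.adjMatrix ℝ) lam b)
    (hdeg : ∀ v, G.degree v ≤ 3) :
    ((univ.filter (fun i => lam i < -√2)).card : ℝ) ≤
      (1 / 2 - 1 / 10000000) * (Fintype.card V : ℝ) := by
  classical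
  -- a maximum family of separated triangles
  let P : Finset (Finset V) → Prop := fun TT =>
    (∀ t ∈ TT, t.card = 3) ∧ (∀ t ∈ TT, ∀ u ∈ t, ∀ v ∈ t, u ≠ v → G.Adj u v) ∧
    (∀ t ∈ TT, ∀ t' ∈ TT, t ≠ t' → ∀ v ∈ t, ∀ u ∈ t', v ≠ u ∧ ¬ G.Adj v u)
  obtain ⟨TT, hTT, hmax⟩ := exists_max_image (univ.filter P) Finset.card
    ⟨∅, by simp [P]⟩
  obtain ⟨hc3, hcl, hsep⟩ := (mem_filter.1 hTT).2
  set T := TT.biUnion id with hT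
  have memT : ∀ {v}, v ∈ T ↔ ∃ t ∈ TT, v ∈ t := by intro v; simp [hT]
  have hTuniq : ∀ t ∈ TT, ∀ t' ∈ TT, ∀ v, v ∈ t → v ∈ t' → t = t' := by
    intro t ht t' ht' v hv hv'
    by_contra hne
    exact (hsep t ht t' ht' hne v hv v hv').1 rfl
  have hTcard : T.card = 3 * TT.card := by
    rw [hT, card_biUnion, (sum_congr rfl hc3 : ∑ u ∈ TT, (id u).card = ∑ _ ∈ TT, 3), sum_const, smul_eq_mul, mul_comm]
    intro t ht t' ht' hne
    rw [Function.onFun, Finset.disjoint_left]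
    intro v hv hv'
    exact hne (hTuniq t ht t' ht' v hv hv')
  -- at most one outside neighbour
  have hone : ∀ v ∈ T, ∀ u u', u ∉ T → u' ∉ T → G.Adj v u → G.Adj v u' → u = u' := by
    intro v hv u u' hu hu' ha ha'
    by_contra hne
    obtain ⟨t, ht, hvt⟩ := memT.1 hv
    have hnt : ∀ w, w ∉ T → w ∉ t := fun w hw hwt => hw (memT.2 ⟨t, ht, hwt⟩)
    have hsub : insert u (insert u' (t.erase v)) ⊆ G.neighborFinset v := by
      intro w hw
      rw [SimpleGraph.mem_neighborFinset]
      simp only [mem_insert, mem_erase] at hw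
      rcases hw with rfl | rfl | hw
      · exact ha
      · exact ha'
      · exact hcl t ht v hvt w hw.2 hw.1.symm
    have h1 := card_le_card hsub
    rw [card_insert_of_notMem, card_insert_of_notMem, card_erase_of_mem hvt, hc3 t ht,
      SimpleGraph.card_neighborFinset_eq_degree] at h1
    · have := hdeg v; omega
    · simp [hnt u' hu']
    · simp [hnt u hu, hne]
  set N := univ.filter (fun u => u ∉ T ∧ ∃ v ∈ T, G.Adj u v) with hNdef
  have memN : ∀ {u}, u ∈ N ↔ u ∉ T ∧ ∃ v ∈ T, G.Adj u v := by intro u; simp [hNdef]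
  -- the rest is triangle free
  have htri : ∀ u v w, u ∉ T ∪ N → v ∉ T ∪ N → w ∉ T ∪ N →
      G.Adj u v → G.Adj v w → G.Adj w u → False := by
    intro u v w hu hv hw huv hvw hwu
    have hnot : ∀ x ∈ ({u, v, w} : Finset V), x ∉ T ∧ ∀ y ∈ T, ¬ G.Adj x y := by
      intro x hx
      have hx : x ∉ T ∪ N := by
        simp only [mem_insert, mem_singleton] at hx
        rcases hx with rfl | rfl | rfl <;> assumption
      rw [notMem_union, memN] at hx
      exact ⟨hx.1, fun y hy hxy => hx.2 ⟨hx.1, y, hy, hxy⟩⟩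
    have hnew : ({u, v, w} : Finset V) ∉ TT := fun hmem =>
      (hnot u (by simp)).1 (memT.2 ⟨_, hmem, by simp⟩)
    have hP : P (insert {u, v, w} TT) := by
      refine ⟨?_, ?_, ?_⟩
      · intro t ht
        rcases mem_insert.1 ht with rfl | ht
        · exact card_eq_three.2 ⟨u, v, w, huv.ne, hwu.ne', hvw.ne, rfl⟩
        · exact hc3 t ht
      · intro t ht
        rcases mem_insert.1 ht with rfl | ht
        · intro x hx y hy hxy
          simp only [mem_insert, mem_singleton] at hx hy
          rcases hx with rfl | rfl | rfl <;> rcases hy with rfl | rfl | rfl <;>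
            first | exact absurd rfl hxy | assumption | (apply SimpleGraph.Adj.symm; assumption)
        · exact hcl t ht
      · intro t ht t' ht' hne x hx y hy
        rcases mem_insert.1 ht with rfl | ht
        · rcases mem_insert.1 ht' with rfl | ht'
          · exact absurd rfl hne
          · have hyT : y ∈ T := memT.2 ⟨t', ht', hy⟩
            exact ⟨fun e => (hnot x hx).1 (e ▸ hyT), (hnot x hx).2 y hyT⟩
        · rcases mem_insert.1 ht' with rfl | ht'
          · have hxT : x ∈ T := memT.2 ⟨t, ht, hx⟩
            exact ⟨fun e => (hnot y hy).1 (e ▸ hxT), fun hadj => (hnot y hy).2 x hxT hadj.symm⟩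
          · exact hsep t ht t' ht' hne x hx y hy
    have := hmax _ (mem_filter.2 ⟨mem_univ _, hP⟩)
    rw [card_insert_of_notMem hnew] at this
    omega
  have hNT : ∀ u ∈ N, u ∉ T := fun u hu => (memN.1 hu).1
  have hb1 := bound_one G h hdeg TT hc3 hcl hsep N hNT
    (fun u hu v hv huv => memN.2 ⟨hu, v, hv, huv⟩) htri
  -- vertices with a unique neighbour in T
  set τ : V → ℕ := fun u => (T.filter (fun v => G.Adj u v)).card with hτ
  set N1 := N.filter (fun u => τ u = 1) with hN1
  have hτsum : ∑ u ∈ N, τ u ≤ T.card := by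
    have := sum_card_bipartiteAbove_eq_sum_card_bipartiteBelow (s := N) (t := T) (fun u v => G.Adj u v)
    rw [show ∑ u ∈ N, τ u = ∑ a ∈ N, (bipartiteAbove (fun u v => G.Adj u v) T a).card from rfl, this]
    rw [card_eq_sum_ones T]
    refine sum_le_sum fun v hv => ?_
    rw [card_le_one]
    intro u hu u' hu'
    simp only [bipartiteBelow, mem_filter] at hu hu'
    exact hone v hv u u' (hNT u hu.1) (hNT u' hu'.1) hu.2.symm hu'.2.symm
  have hτpos : ∀ u ∈ N, 1 ≤ τ u := by
    intro u hu
    obtain ⟨-, v, hv, huv⟩ := memN.1 hu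
    exact card_pos.2 ⟨v, mem_filter.2 ⟨hv, huv⟩⟩
  have hN1card : 2 * N.card ≤ T.card + N1.card := by
    have e : ∑ u ∈ N, 2 ≤ ∑ u ∈ N, (τ u + if τ u = 1 then 1 else 0) := by
      refine sum_le_sum fun u hu => ?_
      have := hτpos u hu
      split_ifs <;> omega
    rw [sum_const, smul_eq_mul, sum_add_distrib, ← card_filter, ← hN1] at e
    omega
  have hN1uniq : ∀ u ∈ N1, ∀ v ∈ T, ∀ v' ∈ T, G.Adj u v → G.Adj u v' → v = v' := by
    intro u hu v hv v' hv' ha ha'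
    have := (mem_filter.1 hu).2
    exact card_le_one.1 this.le v (mem_filter.2 ⟨hv, ha⟩) v' (mem_filter.2 ⟨hv', ha'⟩)
  have hN1T : ∀ u ∈ N1, u ∉ T := fun u hu => hNT u (mem_filter.1 hu).1
  set T1 := T.filter (fun v => ∃ u ∈ N1, G.Adj u v) with hT1
  have hT1card : N1.card ≤ T1.card := by
    refine card_le_card_of_forall_subsingleton (fun u v => G.Adj u v) ?_ ?_
    · intro u hu
      obtain ⟨-, v, hv, huv⟩ := memN.1 (mem_filter.1 hu).1
      exact ⟨v, mem_filter.2 ⟨hv, u, hu, huv⟩, huv⟩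
    · intro v hv u hu u' hu'
      exact hone v (mem_filter.1 hv).1 u u' (hN1T u hu.1) (hN1T u' hu'.1) hu.2.symm hu'.2.symm
  set Good := TT.filter (fun t => t ⊆ T1) with hGood
  have hbad : TT.card ≤ Good.card + (T.card - T1.card) := by
    have h1 : (TT.filter (fun t => ¬ t ⊆ T1)).card ≤ (T \ T1).card := by
      refine card_le_card_of_forall_subsingleton (fun t v => v ∈ t) ?_ ?_
      · intro t ht
        obtain ⟨ht, hts⟩ := mem_filter.1 ht
        obtain ⟨v, hv, hv1⟩ := not_subset.1 hts
        exact ⟨v, mem_sdiff.2 ⟨memT.2 ⟨t, ht, hv⟩, hv1⟩, hv⟩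
      · intro v _ t ht t' ht'
        exact hTuniq t (mem_filter.1 ht.1).1 t' (mem_filter.1 ht'.1).1 v ht.2 ht'.2
    have hs : T1 ⊆ T := filter_subset _ _
    rw [card_sdiff_of_subset hs] at h1
    have h2 := card_filter_add_card_filter_not (s := TT) (fun t => t ⊆ T1)
    rw [← hGood] at h2
    omega
  let Nt : Finset V → Finset V := fun t => N1.filter (fun u => ∃ v ∈ t, G.Adj u v)
  have hNtuniq : ∀ t ∈ TT, ∀ u ∈ Nt t, ∀ v ∈ T, G.Adj u v → v ∈ t := by
    intro t ht u hu v hv huv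
    obtain ⟨hu1, w, hw, huw⟩ := mem_filter.1 hu
    rw [hN1uniq u hu1 v hv w (memT.2 ⟨t, ht, hw⟩) huv huw]
    exact hw
  have hNtdisj : ∀ t ∈ TT, ∀ t' ∈ TT, ∀ u, u ∈ Nt t → u ∈ Nt t' → t = t' := by
    intro t ht t' ht' u hu hu'
    obtain ⟨hu1, w, hw, huw⟩ := mem_filter.1 hu
    exact hTuniq t ht t' ht' w hw (hNtuniq t' ht' u hu' w (memT.2 ⟨t, ht, hw⟩) huw)
  have hNtcard : ∀ t ∈ TT, (Nt t).card ≤ 3 := by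
    intro t ht
    rw [← hc3 t ht]
    refine card_le_card_of_forall_subsingleton (fun u v => G.Adj u v) ?_ ?_
    · intro u hu
      exact (mem_filter.1 hu).2
    · intro v hv u hu u' hu'
      exact hone v (memT.2 ⟨t, ht, hv⟩) u u' (hN1T u (mem_filter.1 hu.1).1)
        (hN1T u' (mem_filter.1 hu'.1).1) hu.2.symm hu'.2.symm
  let conf : Finset V → Finset V → Prop := fun t t' => ∃ u ∈ Nt t, ∃ u' ∈ Nt t', G.Adj u u'
  have hconfcard : ∀ t' ∈ TT, (TT.filter (fun t => conf t t')).card ≤ 9 := by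
    intro t' ht'
    have h1 : (TT.filter (fun t => conf t t')).card ≤
        ((Nt t').biUnion (fun u' => G.neighborFinset u')).card := by
      refine card_le_card_of_forall_subsingleton (fun t u => u ∈ Nt t) ?_ ?_
      · intro t ht
        obtain ⟨-, u, hu, u', hu', huu⟩ := mem_filter.1 ht
        exact ⟨u, mem_biUnion.2 ⟨u', hu', by simpa using huu.symm⟩, hu⟩
      · intro u _ t ht s hs
        exact hNtdisj t (mem_filter.1 ht.1).1 s (mem_filter.1 hs.1).1 u ht.2 hs.2
    have h2 := card_biUnion_le_card_mul (Nt t') (fun u' => G.neighborFinset u') 3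
      (fun u' _ => by rw [SimpleGraph.card_neighborFinset_eq_degree]; exact hdeg u')
    have h3 := hNtcard t' ht'
    omega
  -- maximal conflict free subfamily of good triangles
  obtain ⟨J, hJm, hJmax⟩ := exists_max_image
    (Good.powerset.filter (fun J => ∀ t ∈ J, ∀ t' ∈ J, conf t t' → t = t')) Finset.card
    ⟨∅, by simp⟩
  obtain ⟨hJG, hJc⟩ := mem_filter.1 hJm
  rw [mem_powerset] at hJG
  have hconfsymm : ∀ t t', conf t t' → conf t' t := by
    rintro t t' ⟨u, hu, u', hu', huu⟩
    exact ⟨u', hu', u, hu, huu.symm⟩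
  have hGJ : Good.card ≤ 10 * J.card := by
    have hsub : Good ⊆ J.biUnion (fun t' => insert t' (TT.filter (fun t => conf t t'))) := by
      intro t ht
      rw [mem_biUnion]
      by_cases htJ : t ∈ J
      · exact ⟨t, htJ, mem_insert_self _ _⟩
      by_contra hcon
      push Not at hcon
      have hno : ∀ t' ∈ J, ¬ conf t t' := by
        intro t' ht' hc
        exact hcon t' ht' (mem_insert_of_mem (mem_filter.2 ⟨(mem_filter.1 ht).1, hc⟩))
      have := hJmax (insert t J) (mem_filter.2 ⟨mem_powerset.2 (insert_subset ht hJG), ?_⟩)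
      · rw [card_insert_of_notMem htJ] at this
        omega
      · intro s hs s' hs' hc
        rcases mem_insert.1 hs with rfl | hs2 <;> rcases mem_insert.1 hs' with rfl | hs2'
        · rfl
        · exact absurd hc (hno s' hs2')
        · exact absurd (hconfsymm _ _ hc) (hno s hs2)
        · exact hJc s hs2 s' hs2' hc
    have h1 := card_le_card hsub
    have h2 := card_biUnion_le_card_mul J
      (fun t' => insert t' (TT.filter (fun t => conf t t'))) 10 (fun t' ht' => by
        have := hconfcard t' (mem_filter.1 (hJG ht')).1
        exact (card_insert_le _ _).trans (by omega))
    omega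
  have hJT : J ⊆ TT := fun t ht => (mem_filter.1 (hJG ht)).1
  have hgoodJ : ∀ t ∈ J, ∀ v ∈ t, ∃ u ∈ Nt t, G.Adj v u ∧
      ∀ w, w ∉ TT.biUnion id → G.Adj v w → w = u := by
    intro t ht v hv
    have hv1 := (mem_filter.1 (hJG ht)).2 hv
    obtain ⟨hvT, u, hu, huv⟩ := mem_filter.1 hv1
    exact ⟨u, mem_filter.2 ⟨hu, v, hv, huv⟩, huv.symm,
      fun w hw hvw => hone v hvT w u hw (hN1T u hu) hvw huv.symm⟩
  have hb2 := bound_two G h TT J Nt hJT hcl hsep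
    (fun t ht u hu => hN1T u (mem_filter.1 hu).1)
    (fun t ht => by
      have : 0 < t.card := by rw [hc3 t (hJT ht)]; norm_num
      obtain ⟨v, hv⟩ := card_pos.1 this
      obtain ⟨u, hu, -⟩ := hgoodJ t ht v hv
      exact ⟨u, hu⟩)
    (fun t ht t' ht' u hu hu' => hNtdisj t (hJT ht) t' (hJT ht') u hu hu')
    (fun t ht t' ht' u hu u' hu' huu => hJc t ht t' ht' ⟨u, hu, u', hu', huu⟩)
    hgoodJ
    (fun t ht u hu v hv huv => hNtuniq t (hJT ht) u hu v hv huv.symm)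
  -- counting
  have hdisj : Disjoint T N := by
    rw [Finset.disjoint_left]
    intro v hv hv'
    exact hNT v hv' hv
  have hcardV : T.card + N.card + (T ∪ N)ᶜ.card = Fintype.card V := by
    rw [← card_union_of_disjoint hdisj, card_add_card_compl]
  have hT1le : T1.card ≤ T.card := card_le_card (filter_subset _ _)
  have hbad' : TT.card + T1.card ≤ Good.card + T.card := by omega
  rw [← hT] at hb1 hb2
  have r1 : (T.card : ℝ) = 3 * TT.card := by exact_mod_cast hTcard
  have r2 : 2 * (N.card : ℝ) ≤ T.card + N1.card := by exact_mod_cast hN1card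
  have r3 : (N1.card : ℝ) ≤ T1.card := by exact_mod_cast hT1card
  have r4 : (TT.card : ℝ) + T1.card ≤ Good.card + T.card := by exact_mod_cast hbad'
  have r5 : (Good.card : ℝ) ≤ 10 * J.card := by exact_mod_cast hGJ
  have r6 : (T.card : ℝ) + N.card + (T ∪ N)ᶜ.card = Fintype.card V := by exact_mod_cast hcardV
  have r7 : ((univ.filter (fun i => lam i < -√2)).card : ℝ) + (T.card + J.card) ≤
    Fintype.card V := by exact_mod_cast hb2
  have r8 : (0:ℝ) ≤ (T ∪ N)ᶜ.card := Nat.cast_nonneg _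
  have r9 : (0:ℝ) ≤ TT.card := Nat.cast_nonneg _
  have r10 : (0:ℝ) ≤ N.card := Nat.cast_nonneg _
  have r11 : (N.card : ℝ) ≤ T.card := by
    have := sum_le_sum hτpos
    rw [sum_const, smul_eq_mul, mul_one] at this
    exact_mod_cast this.trans hτsum
  generalize ((univ.filter (fun i => lam i < -√2)).card : ℝ) = k at *
  generalize ((T ∪ N)ᶜ.card : ℝ) = ρ at *
  rw [← r6]
  linarith
end neg

theorem spec_multiset {α β : Type*} [Fintype α] [Fintype β] (f : α → ℝ) (g : β → ℝ)
    (h : ∏ i, (Polynomial.X - Polynomial.C (f i)) = ∏ i, (Polynomial.X - Polynomial.C (g i)))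
    (p : ℝ → Prop) [DecidablePred p] :
    (Finset.univ.filter (fun i => p (f i))).card = (Finset.univ.filter (fun i => p (g i))).card := by
  have e : ∀ {γ : Type _} [Fintype γ] (f : γ → ℝ),
      (∏ i, (Polynomial.X - Polynomial.C (f i))).roots = Finset.univ.val.map f := by
    intro γ _ f
    have := Polynomial.roots_multiset_prod_X_sub_C (Finset.univ.val.map f)
    rw [← this, Multiset.map_map]
    rfl
  have h2 : Finset.univ.val.map f = Finset.univ.val.map g := by
    have e2 : (∏ i, (Polynomial.X - Polynomial.C (g i))).roots = Finset.univ.val.map g := by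
      have := Polynomial.roots_multiset_prod_X_sub_C (Finset.univ.val.map g)
      rw [← this, Multiset.map_map]
      rfl
    rw [← e f, ← e2, h]
  have c : ∀ {γ : Type _} [Fintype γ] (f : γ → ℝ),
      (Finset.univ.filter (fun i => p (f i))).card = (Finset.univ.val.map f).countP p := by
    intro γ _ f
    rw [Multiset.countP_map]; rfl
  rw [c f, h2, Multiset.countP_map]; rfl

theorem median_band_of_subcubic_in_sqrt_two_interval :
    ∃ δ : ℝ, 0 < δ ∧
      ∀ (n : ℕ) (G : SimpleGraph (Fin n)) (_ : DecidableRel G.Adj),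
        (∀ v, G.degree v ≤ 3) →
        ∀ (μ : Fin (Fintype.card (Fin n)) → ℝ), G.IsEigenvalueSeq μ →
          ∀ i : Fin (Fintype.card (Fin n)),
            (1 / 2 - δ) * (n : ℝ) ≤ ((i : ℕ) + 1 : ℝ) →
            ((i : ℕ) + 1 : ℝ) ≤ (1 / 2 + δ) * (n : ℝ) →
            -Real.sqrt 2 ≤ μ i ∧ μ i ≤ Real.sqrt 2 := by
  refine ⟨1 / 20000000, by norm_num, ?_⟩
  intro n G inst hdeg μ hμ i h1 h2
  obtain ⟨lam, b, hs, hc⟩ := exists_isSpec (G.adjMatrix ℝ) (by ext u v; simp [SimpleGraph.adjMatrix_apply, SimpleGraph.adj_comm])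
  obtain ⟨hanti, hchar⟩ := hμ
  have hpoly : ∏ j, (Polynomial.X - Polynomial.C (lam j)) =
      ∏ j, (Polynomial.X - Polynomial.C (μ j)) := by
    rw [← hc, ← hchar]
    congr!
  have hp := pos_count G hs hdeg
  have hn := neg_count G hs hdeg
  rw [spec_multiset lam μ hpoly (fun x => √2 < x)] at hp
  rw [spec_multiset lam μ hpoly (fun x => x < -√2)] at hn
  have hi : (i : ℕ) < n := i.2.trans_eq (Fintype.card_fin n)
  have hipos : 0 < (n:ℝ) := by exact_mod_cast (Nat.zero_le _).trans_lt hi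
  have hN : ((Fintype.card (Fin n) : ℕ) : ℝ) = (n : ℝ) := by rw [Fintype.card_fin]
  rw [hN] at hp hn
  constructor
  · by_contra hcon
    push Not at hcon
    have : (Finset.univ.filter (fun j => i ≤ j)).card ≤
        (Finset.univ.filter (fun j => μ j < -√2)).card := by
      apply Finset.card_le_card
      intro j hj
      simp only [Finset.mem_filter, Finset.mem_univ, true_and] at hj ⊢
      exact (hanti hj).trans_lt hcon
    have e : (Finset.univ.filter (fun j => i ≤ j)).card = Fintype.card (Fin n) - i := by
      rw [← Fin.card_Ici]; congr 1; ext j; simp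
    have hN' := Fintype.card_fin n
    have t2 : (n:ℝ) - (i:ℕ) ≤ ((Finset.univ.filter (fun j => μ j < -√2)).card : ℝ) := by
      have : n ≤ (Finset.univ.filter (fun j => μ j < -√2)).card + (i:ℕ) := by omega
      have : (n:ℝ) ≤ (Finset.univ.filter (fun j => μ j < -√2)).card + (i:ℕ) := by
        exact_mod_cast this
      linarith
    linarith
  · by_contra hcon
    push Not at hcon
    have : (Finset.univ.filter (fun j => j ≤ i)).card ≤
        (Finset.univ.filter (fun j => √2 < μ j)).card := by
      apply Finset.card_le_card
      intro j hj
      simp only [Finset.mem_filter, Finset.mem_univ, true_and] at hj ⊢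
      exact hcon.trans_le (hanti hj)
    have e : (Finset.univ.filter (fun j => j ≤ i)).card = i + 1 := by
      rw [← Fin.card_Iic]; congr 1; ext j; simp
    rw [e] at this
    have t2 : ((i:ℕ):ℝ) + 1 ≤ ((Finset.univ.filter (fun j => √2 < μ j)).card : ℝ) := by
      exact_mod_cast this
    linarith
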